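/- arXiv:1407.6065 — 3 statements merged into one kernel-verified Lean document; each statement's English description precedes it below -/
import Mathlib

section
/- Let α, ϑ be real numbers, L a positive integer, and (y_n) a real sequence such that for every ℓ ∈ {1,…,L} the subsequence (y_{nL+ℓ}) converges. Then the sequence (nϑ + α·ln n + y_n) is uniformly distributed mod 1 if and only if ϑ is irrational. -/
open scoped Classical

/-- A real sequence is uniformly distributed mod 1. -/
def UDMod1 (x : ℕ → ℝ) : Prop :=
  ∀ a c : ℝ, 0 ≤ a → a ≤ c → c ≤ 1 →
    Filter.Tendsto
      (fun N : ℕ => (((Finset.Icc 1 N).filter fun n => Int.fract (x n) ∈ Set.Ico a c).card : ℝ) / N)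
      Filter.atTop (nhds (c - a))

open Filter Topology MeasureTheory

lemma integral_fourier_zero (h : ℤ) (hh : h ≠ 0) :
    ∫ t : UnitAddCircle, (fourier h t : ℂ) = 0 := by
  exact integral_eq_zero_of_add_right_eq_neg (fourier_add_half_inv_index hh one_pos)

lemma avg_tendsto (x : ℕ → ℝ)
    (hx : ∀ h : ℤ, h ≠ 0 → Tendsto (fun N : ℕ =>
      (∑ n ∈ Finset.Icc 1 N, (fourier h (x n : UnitAddCircle) : ℂ)) / N) atTop (𝓝 0))
    (f : C(UnitAddCircle, ℂ)) :
    Tendsto (fun N : ℕ => (∑ n ∈ Finset.Icc 1 N, f (x n : UnitAddCircle)) / (N : ℂ)) atTop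
      (𝓝 (∫ t, f t)) := by
  have hI : ∀ f : C(UnitAddCircle, ℂ), Integrable f volume := fun f =>
    f.continuous.integrable_of_hasCompactSupport (HasCompactSupport.of_compactSpace _)
  have hspan : ∀ f ∈ Submodule.span ℂ (Set.range (@fourier 1)),
      Tendsto (fun N : ℕ => (∑ n ∈ Finset.Icc 1 N, f (x n : UnitAddCircle)) / (N : ℂ)) atTop
      (𝓝 (∫ t, f t)) := by
    intro f hf
    induction hf using Submodule.span_induction with
    | mem f hf =>
      obtain ⟨h, rfl⟩ := hf
      by_cases hh : h = 0
      · subst hh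
        simp only [fourier_zero]
        simp
        refine tendsto_const_nhds.congr' ?_
        filter_upwards [eventually_gt_atTop 0] with N hN
        have : (N : ℂ) ≠ 0 := by exact_mod_cast hN.ne'
        field_simp
        simp [Measure.real]
      · rw [integral_fourier_zero h hh]
        exact hx h hh
    | zero => simp
    | add f g _ _ hf hg =>
      have := hf.add hg
      rw [← integral_add (hI f) (hI g)] at this
      refine this.congr fun N => ?_
      simp [Finset.sum_add_distrib, add_div]
    | smul c f _ hf =>
      have := hf.const_mul c
      rw [← integral_const_mul] at this
      refine this.congr fun N => ?_
      simp only [ContinuousMap.smul_apply, smul_eq_mul]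
      rw [← Finset.mul_sum, mul_div_assoc]
  have hf : f ∈ closure (Submodule.span ℂ (Set.range (@fourier 1)) : Set C(UnitAddCircle, ℂ)) := by
    have : f ∈ (Submodule.span ℂ (Set.range (@fourier 1))).topologicalClosure := by
      rw [span_fourier_closure_eq_top]; trivial
    exact this
  rw [Metric.tendsto_atTop]
  intro ε hε
  obtain ⟨g, hg, hfg⟩ := Metric.mem_closure_iff.1 hf (ε/3) (by positivity)
  obtain ⟨N0, hN0⟩ := Metric.tendsto_atTop.1 (hspan g hg) (ε/3) (by positivity)
  refine ⟨N0 + 1, fun N hN => ?_⟩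
  have hNpos : (0:ℝ) < N := by exact_mod_cast (by omega : 0 < N)
  have h1 := hN0 N (by omega)
  have hpt : ∀ t, ‖f t - g t‖ ≤ ε / 3 := fun t => by
    rw [← dist_eq_norm]
    exact (ContinuousMap.dist_apply_le_dist t).trans hfg.le
  have h2 : dist ((∑ n ∈ Finset.Icc 1 N, f (x n : UnitAddCircle)) / (N : ℂ))
      ((∑ n ∈ Finset.Icc 1 N, g (x n : UnitAddCircle)) / (N : ℂ)) ≤ ε / 3 := by
    rw [dist_eq_norm, ← sub_div, ← Finset.sum_sub_distrib, norm_div, Complex.norm_natCast,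
      div_le_iff₀ hNpos]
    refine (norm_sum_le_of_le _ (fun n _ => hpt _)).trans ?_
    simp [mul_comm]
  have h3 : dist (∫ t, g t) (∫ t, f t) ≤ ε / 3 := by
    rw [dist_comm, dist_eq_norm, ← integral_sub (hI f) (hI g)]
    refine (norm_integral_le_of_norm_le_const (C := ε/3) (Eventually.of_forall hpt)).trans ?_
    simp [Measure.real]
  calc _ ≤ _ := dist_triangle4 _ _ _ _
    _ < _ := by linarith

lemma weyl_suff (x : ℕ → ℝ)
    (hx : ∀ h : ℤ, h ≠ 0 → Tendsto (fun N : ℕ =>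
      (∑ n ∈ Finset.Icc 1 N, (fourier h (x n : UnitAddCircle) : ℂ)) / N) atTop (𝓝 0)) :
    UDMod1 x := by
  intro a c ha hac hc
  rw [← tendsto_add_atTop_iff_nat 1]
  let ν : ℕ → Measure UnitAddCircle := fun N =>
    (ENNReal.ofReal ((N+1 : ℝ)⁻¹)) • ∑ n ∈ Finset.Icc 1 (N+1), Measure.dirac (x n : UnitAddCircle)
  have hν : ∀ N, IsProbabilityMeasure (ν N) := fun N => ⟨by
    have : (0:ℝ) < N + 1 := by positivity
    simp only [ν, Measure.smul_apply, Measure.finsetSum_apply, measure_univ]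
    simp
    rw [ENNReal.ofReal_inv_of_pos this, show (N:ENNReal) + 1 = ENNReal.ofReal ((N:ℝ) + 1) by
      rw [ENNReal.ofReal_add] <;> simp]
    apply ENNReal.inv_mul_cancel
    · simpa using this
    · simp⟩
  have hvol : IsProbabilityMeasure (volume : Measure UnitAddCircle) := ⟨by simp⟩
  let μ : ℕ → ProbabilityMeasure UnitAddCircle := fun N => ⟨ν N, hν N⟩
  let P : ProbabilityMeasure UnitAddCircle := ⟨volume, hvol⟩
  have hlim : Tendsto μ atTop (𝓝 P) := by
    refine ProbabilityMeasure.tendsto_iff_forall_integral_tendsto.2 ?_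
    intro f
    have h1 := avg_tendsto x hx ⟨fun t => ((f t : ℝ) : ℂ), by fun_prop⟩
    have h2 := (Complex.continuous_re.tendsto _).comp h1
    rw [← tendsto_add_atTop_iff_nat 1] at h2
    have e : (∫ t : UnitAddCircle, ((f t : ℝ) : ℂ)).re = ∫ t, f t := by
      rw [integral_complex_ofReal, Complex.ofReal_re]
    simp only [ContinuousMap.coe_mk, e] at h2
    refine h2.congr fun N => ?_
    have : (0:ℝ) < N + 1 := by positivity
    simp only [μ, ν, ProbabilityMeasure.coe_mk, integral_smul_measure]
    rw [integral_finsetSum_measure (fun i _ => integrable_dirac (by simp))]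
    simp only [integral_dirac, Function.comp, ENNReal.toReal_ofReal (inv_nonneg.2 this.le)]
    rw [← Complex.ofReal_sum, ← Complex.ofReal_natCast, ← Complex.ofReal_div, Complex.ofReal_re]
    push_cast
    rw [div_eq_inv_mul, smul_eq_mul]
  let E : Set UnitAddCircle := (fun t : ℝ => (t : UnitAddCircle)) '' Set.Ico a c
  have hmemE : ∀ t : ℝ, (t : UnitAddCircle) ∈ E ↔ Int.fract t ∈ Set.Ico a c := by
    intro t
    constructor
    · rintro ⟨s, hs, hst⟩
      have : Int.fract t = s := by
        have h1 : ((Int.fract t : ℝ) : UnitAddCircle) = s := by simpa using hst.symm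
        exact (AddCircle.coe_eq_coe_iff_of_mem_Ico (a := (0:ℝ)) (p := 1)
          ⟨Int.fract_nonneg t, by simpa using Int.fract_lt_one t⟩
          ⟨ha.trans hs.1, by simpa using hs.2.trans_le hc⟩).1 h1
      rwa [this]
    · intro h
      exact ⟨_, h, by simp⟩
  have hsing : ∀ t : UnitAddCircle, volume {t} = 0 := fun t => by
    have := AddCircle.volume_closedBall (T := 1) (x := t) 0
    simpa using this
  have hsub : E ⊆ (fun t : ℝ => (t : UnitAddCircle)) '' Set.Icc a c :=
    Set.image_mono Set.Ico_subset_Icc_self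
  have hclosed : IsClosed ((fun t : ℝ => (t : UnitAddCircle)) '' Set.Icc a c) :=
    (isCompact_Icc.image (AddCircle.continuous_mk' 1)).isClosed
  have hopen : IsOpen ((fun t : ℝ => (t : UnitAddCircle)) '' Set.Ioo a c) :=
    QuotientAddGroup.isOpenMap_coe _ isOpen_Ioo
  have hfr : frontier E ⊆ {(a : UnitAddCircle), (c : UnitAddCircle)} := by
    rintro z ⟨h1, h2⟩
    obtain ⟨t, ht, rfl⟩ := closure_minimal hsub hclosed h1
    have : ¬ (t ∈ Set.Ioo a c) := fun h => h2 (interior_maximal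
      (Set.image_mono Set.Ioo_subset_Ico_self) hopen ⟨t, h, rfl⟩)
    have : t = a ∨ t = c := by
      by_contra! hh
      exact this ⟨lt_of_le_of_ne ht.1 hh.1.symm, lt_of_le_of_ne ht.2 hh.2⟩
    rcases this with rfl | rfl <;> simp
  have hfr0 : volume (frontier E) = 0 := by
    refine measure_mono_null hfr ?_
    rw [Set.insert_eq]
    exact measure_union_null (hsing _) (hsing _)
  have hEm : MeasurableSet E := by
    have : E = ((fun t : ℝ => (t : UnitAddCircle)) '' Set.Ioo a c) ∪ (E ∩ {(a : UnitAddCircle)}) := by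
      ext z
      constructor
      · rintro ⟨t, ht, rfl⟩
        by_cases h : t = a
        · right; exact ⟨⟨t, ht, rfl⟩, by simp [h]⟩
        · left; exact ⟨t, ⟨lt_of_le_of_ne ht.1 (Ne.symm h), ht.2⟩, rfl⟩
      · rintro (h | h)
        · exact Set.image_mono Set.Ioo_subset_Ico_self h
        · exact h.1
    rw [this]
    exact hopen.measurableSet.union (((Set.finite_singleton _).inter_of_right _).measurableSet)
  have hvE : volume E = ENNReal.ofReal (c - a) := by
    rw [AddCircle.add_projection_respects_measure 1 0 hEm, ← Real.volume_Ico]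
    have : volume ({0, 1} : Set ℝ) = 0 := (Set.toFinite _).measure_zero _
    apply measure_congr
    rw [MeasureTheory.measure_eq_zero_iff_ae_notMem] at this
    filter_upwards [this] with t ht
    simp only [Set.mem_insert_iff, Set.mem_singleton_iff, not_or] at ht
    apply propext
    change ((t : UnitAddCircle) ∈ E ∧ t ∈ Set.Ioc 0 (0+1)) ↔ t ∈ Set.Ico a c
    rw [hmemE]
    constructor
    · rintro ⟨h1, h2⟩
      rwa [Int.fract_eq_self.2 ⟨h2.1.le, lt_of_le_of_ne (by simpa using h2.2) ht.2⟩] at h1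
    · intro h
      rw [Int.fract_eq_self.2 ⟨ha.trans h.1, h.2.trans_le hc⟩]
      exact ⟨h, lt_of_le_of_ne (ha.trans h.1) (Ne.symm ht.1), by linarith [h.2]⟩
  have key := ProbabilityMeasure.tendsto_measure_of_null_frontier_of_tendsto' hlim (E := E) hfr0
  have key2 := (ENNReal.tendsto_toReal (by simp)).comp key
  have e : ((volume : Measure UnitAddCircle) E).toReal = c - a := by
    rw [hvE, ENNReal.toReal_ofReal (by linarith)]
  rw [← e]
  refine key2.congr fun N => ?_
  have : (0:ℝ) < N + 1 := by positivity
  simp only [μ, ν, Function.comp, ProbabilityMeasure.coe_mk, Measure.smul_apply,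
    Measure.finsetSum_apply, Measure.dirac_apply' _ hEm, smul_eq_mul, ENNReal.toReal_mul,
    ENNReal.toReal_ofReal (inv_nonneg.2 this.le)]
  rw [div_eq_inv_mul]
  push_cast
  congr 1
  rw [ENNReal.toReal_sum (fun i _ => by by_cases hi : (x i : UnitAddCircle) ∈ E <;> simp [hi])]
  rw [Finset.card_filter]
  push_cast
  refine Finset.sum_congr rfl fun i _ => ?_
  by_cases hi : (x i : UnitAddCircle) ∈ E
  · rw [if_pos ((hmemE _).1 hi)]; simp [hi]
  · rw [if_neg (fun h => hi ((hmemE _).2 h))]; simp [hi]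

lemma residue_eventually (L : ℕ) (hL : 1 ≤ L) (P : ℕ → Prop)
    (h : ∀ ℓ : ℕ, 1 ≤ ℓ → ℓ ≤ L → ∀ᶠ k in atTop, P (k * L + ℓ)) : ∀ᶠ n in atTop, P n := by
  have h1 : ∀ᶠ k in atTop, ∀ ℓ ∈ Finset.Icc 1 L, P (k * L + ℓ) := by
    rw [Filter.eventually_all_finset]
    intro ℓ hℓ
    rw [Finset.mem_Icc] at hℓ
    exact h ℓ hℓ.1 hℓ.2
  obtain ⟨K, hK⟩ := eventually_atTop.1 h1
  refine eventually_atTop.2 ⟨K * L + 1, fun n hn => ?_⟩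
  have h2 : K ≤ (n - 1) / L := (Nat.le_div_iff_mul_le (by omega)).2 (by omega)
  have h3 := Nat.mod_lt (n - 1) (show L > 0 by omega)
  have h4 := hK _ h2 ((n - 1) % L + 1) (Finset.mem_Icc.2 ⟨by omega, by omega⟩)
  have h5 := Nat.div_add_mod (n - 1) L
  have : (n - 1) / L * L + ((n - 1) % L + 1) = n := by
    rw [mul_comm ((n - 1) / L) L]; omega
  rwa [this] at h4

lemma twisted (L : ℕ) (b : ℕ → ℂ) (z : ℂ) (hz : ‖z‖ = 1) (hzL : z ^ L ≠ 1)
    (hb : ∀ n, ‖b n‖ ≤ 1) (hd : Tendsto (fun n => b (n + L) - b n) atTop (𝓝 0)) :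
    Tendsto (fun N : ℕ => (∑ n ∈ Finset.Icc 1 N, z ^ n * b n) / (N : ℂ)) atTop (𝓝 0) := by
  let g : ℕ → ℂ := fun n => z ^ (n + 1) * b (n + 1)
  have hg : ∀ n, ‖g n‖ ≤ 1 := fun n => by simp [g, hz, hb]
  let w : ℕ → ℂ := fun n => z ^ L * g n - g (n + L)
  have hw : Tendsto w atTop (𝓝 0) := by
    rw [tendsto_zero_iff_norm_tendsto_zero] at hd ⊢
    refine ((tendsto_add_atTop_iff_nat 1).2 hd).congr fun n => ?_
    have : w n = - (z ^ (n + 1 + L) * (b (n + 1 + L) - b (n + 1))) := by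
      simp only [w, g, add_right_comm n L 1]; ring
    rw [this, norm_neg, norm_mul, norm_pow, hz, one_pow, one_mul]
  have hc := hw.cesaro_smul
  let R : ℕ → ℂ := fun N => ∑ i ∈ Finset.range L, g (N + i) - ∑ i ∈ Finset.range L, g i
  have hR : ∀ N, ‖R N‖ ≤ 2 * L := fun N => by
    refine (norm_sub_le _ _).trans ?_
    have h1 := norm_sum_le_of_le (Finset.range L) (fun i _ => hg (N + i))
    have h2 := norm_sum_le_of_le (Finset.range L) (fun i _ => hg i)
    simp at h1 h2
    linarith
  have hR0 : Tendsto (fun N : ℕ => R N / (N : ℂ)) atTop (𝓝 0) := by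
    refine squeeze_zero_norm (a := fun N : ℕ => (2 * L : ℝ) / N) (fun N => ?_)
      (tendsto_const_div_atTop_nhds_zero_nat _)
    rw [norm_div, Complex.norm_natCast]
    gcongr
    exact hR N
  have hS : ∀ N, (z ^ L - 1) * ∑ n ∈ Finset.range N, g n = ∑ n ∈ Finset.range N, w n + R N := by
    intro N
    have e1 := Finset.sum_range_add g N L
    have e2 := Finset.sum_range_add g L N
    rw [add_comm L N] at e2
    simp only [w, R, Finset.sum_sub_distrib, ← Finset.mul_sum]
    simp only [add_comm L] at e2
    linear_combination e1 - e2
  have hfin := (hc.add hR0).const_mul (z ^ L - 1)⁻¹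
  simp only [add_zero, mul_zero] at hfin
  refine hfin.congr fun N => ?_
  have hne : z ^ L - 1 ≠ 0 := sub_ne_zero.2 hzL
  have hI : ∑ n ∈ Finset.Icc 1 N, z ^ n * b n = ∑ n ∈ Finset.range N, g n := by
    rw [Finset.range_eq_Ico, Finset.sum_Ico_add' (fun n => z ^ n * b n) 0 N 1]
    rfl
  rw [hI, inv_mul_eq_iff_eq_mul₀ hne, ← mul_div_assoc, hS, add_div, Complex.real_smul]
  push_cast
  rw [inv_mul_eq_div]

lemma log_diff (L : ℕ) :
    Tendsto (fun n : ℕ => Real.log ((n + L : ℕ) : ℝ) - Real.log n) atTop (𝓝 0) := by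
  refine squeeze_zero' (g := fun n : ℕ => (L : ℝ) / n) ?_ ?_
    (tendsto_const_div_atTop_nhds_zero_nat _)
  · filter_upwards [eventually_gt_atTop 0] with n hn
    have : (0:ℝ) < n := by exact_mod_cast hn
    rw [sub_nonneg]
    apply Real.log_le_log this
    push_cast
    linarith [(Nat.cast_nonneg L : (0:ℝ) ≤ L)]
  · filter_upwards [eventually_gt_atTop 0] with n hn
    have : (0:ℝ) < n := by exact_mod_cast hn
    have h0 : (0:ℝ) ≤ L := Nat.cast_nonneg L
    rw [← Real.log_div (by push_cast; positivity) this.ne']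
    refine (Real.log_le_sub_one_of_pos (by push_cast; positivity)).trans (le_of_eq ?_)
    push_cast
    field_simp
    ring

lemma irr_dir (α ϑ : ℝ) (L : ℕ) (hL : 1 ≤ L) (y : ℕ → ℝ)
    (hy : Tendsto (fun n => y (n + L) - y n) atTop (𝓝 0)) (hϑ : Irrational ϑ) :
    UDMod1 (fun n => (n : ℝ) * ϑ + α * Real.log n + y n) := by
  apply weyl_suff
  intro h hh
  let F : ℝ → ℂ := fun t => fourier h (t : UnitAddCircle)
  have hF : ∀ t, F t = Complex.exp (2 * Real.pi * Complex.I * h * t) := fun t => by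
    simp only [F, fourier_coe_apply]; simp
  have hFa : ∀ s t, F (s + t) = F s * F t := fun s t => by
    rw [hF, hF, hF, ← Complex.exp_add]; push_cast; ring_nf
  have hFp : ∀ (n : ℕ) t, F (n * t) = F t ^ n := fun n t => by
    rw [hF, hF, ← Complex.exp_nat_mul]; push_cast; ring_nf
  have hFn : ∀ t, ‖F t‖ = 1 := fun t => by
    rw [hF, show (2 * Real.pi * Complex.I * h * t : ℂ) = ((2 * Real.pi * h * t : ℝ) : ℂ) * Complex.I by
      push_cast; ring, Complex.norm_exp_ofReal_mul_I]
  have hFc : Continuous F := by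
    have : F = fun t : ℝ => Complex.exp (2 * Real.pi * Complex.I * h * t) := funext hF
    rw [this]; fun_prop
  let b : ℕ → ℂ := fun n => F (α * Real.log n + y n)
  have hd : Tendsto (fun n => b (n + L) - b n) atTop (𝓝 0) := by
    have h1 : Tendsto (fun n : ℕ => α * (Real.log ((n + L : ℕ) : ℝ) - Real.log n)
        + (y (n + L) - y n)) atTop (𝓝 0) := by
      simpa using ((log_diff L).const_mul α).add hy
    have h2 := (((hFc.tendsto 0).comp h1).sub_const 1).norm
    have h0 : F 0 = 1 := by simp [hF]
    rw [tendsto_zero_iff_norm_tendsto_zero]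
    rw [h0, sub_self, norm_zero] at h2
    refine h2.congr fun n => ?_
    have e : b (n + L) = b n * F (α * (Real.log ((n + L : ℕ) : ℝ) - Real.log n)
        + (y (n + L) - y n)) := by
      simp only [b]; rw [← hFa]; congr 1; ring
    rw [e, ← mul_sub_one, norm_mul, hFn, one_mul]
    rfl
  have hzL : F ϑ ^ L ≠ 1 := by
    rw [← hFp, hF]
    intro h1
    obtain ⟨m, hm⟩ := Complex.exp_eq_one_iff.1 h1
    have hpi : (2 * Real.pi * Complex.I : ℂ) ≠ 0 := Complex.two_pi_I_ne_zero
    have h2 : (h : ℂ) * ((L * ϑ : ℝ) : ℂ) = m := by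
      apply mul_left_cancel₀ hpi
      linear_combination hm
    have h3 : (h : ℝ) * (L * ϑ) = m := by exact_mod_cast h2
    have h4 : Irrational ((h : ℝ) * (L * ϑ)) :=
      (hϑ.natCast_mul (by omega)).intCast_mul hh
    exact h4.ne_int m h3
  refine (twisted L b (F ϑ) (hFn _) hzL (fun n => (hFn _).le) hd).congr fun N => ?_
  congr 1
  refine Finset.sum_congr rfl fun n _ => ?_
  change _ = F _
  rw [← hFp, ← hFa]
  congr 1
  ring

lemma window (x : ℕ → ℝ) (hx : UDMod1 x) (D : ℕ) (hD : 1 ≤ D) (a c : ℝ) (ha : 0 ≤ a)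
    (hac : a < c) (hc : c ≤ 1) :
    ∀ᶠ k : ℕ in atTop, ∃ n, D * k < n ∧ n ≤ (D + 1) * k ∧ Int.fract (x n) ∈ Set.Ico a c := by
  have h := hx a c ha hac.le hc
  let C : ℕ → ℕ := fun N => ((Finset.Icc 1 N).filter fun n => Int.fract (x n) ∈ Set.Ico a c).card
  have aux : ∀ E : ℕ, 1 ≤ E → Tendsto (fun k : ℕ => (C (E * k) : ℝ) / k) atTop
      (𝓝 (E * (c - a))) := by
    intro E hE
    have h1 : Tendsto (fun k : ℕ => E * k) atTop atTop :=
      tendsto_id.const_mul_atTop' (by omega)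
    refine ((h.comp h1).const_mul (E : ℝ)).congr fun k => ?_
    have : (E : ℝ) ≠ 0 := by positivity
    simp only [Function.comp, C]
    push_cast
    field_simp
  have h2 := (aux (D + 1) (by omega)).sub (aux D hD)
  have h3 : (0 : ℝ) < ((D + 1 : ℕ) : ℝ) * (c - a) - D * (c - a) := by push_cast; linarith
  filter_upwards [h2.eventually_const_lt h3] with k hk
  by_contra! hno
  have : C ((D + 1) * k) = C (D * k) := by
    simp only [C]
    congr 1
    ext n
    simp only [Finset.mem_filter, Finset.mem_Icc]
    constructor
    · rintro ⟨⟨h1, h2⟩, h3⟩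
      refine ⟨⟨h1, ?_⟩, h3⟩
      by_contra! h4
      exact hno n h4 h2 h3
    · rintro ⟨⟨h1, h2⟩, h3⟩
      exact ⟨⟨h1, h2.trans (Nat.mul_le_mul_right _ (by omega))⟩, h3⟩
  rw [this, sub_self] at hk
  exact lt_irrefl _ hk

lemma rat_dir (α : ℝ) (r : ℚ) (L : ℕ) (hL : 1 ≤ L) (y : ℕ → ℝ) (d : ℕ → ℝ)
    (hy : ∀ ε > 0, ∀ᶠ n in atTop, |y n - d ((n - 1) % L)| < ε)
    (hx : UDMod1 (fun n => (n : ℝ) * r + α * Real.log n + y n)) : False := by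
  obtain ⟨x, hxdef⟩ : ∃ x : ℕ → ℝ, x = fun n : ℕ => (n : ℝ) * r + α * Real.log n + y n := ⟨_, rfl⟩
  rw [← hxdef] at hx
  let M : ℕ := r.den * L
  have hM : 1 ≤ M := Nat.mul_pos r.den_pos (by omega)
  obtain ⟨κ, hκ⟩ : ∃ κ : ℝ, κ = 1 / (2 * (M + 1)) := ⟨_, rfl⟩
  have hκ0 : 0 < κ := by rw [hκ]; positivity
  have hκ1 : (2 * (M + 1)) * κ = 1 := by rw [hκ]; field_simp
  obtain ⟨D0, hD0⟩ := exists_nat_gt (|α| / (κ / 2))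
  let D := D0 + 1
  have hD : |α| / D < κ / 2 := by
    have : (0:ℝ) < D := by positivity
    rw [div_lt_iff₀ this]
    rw [div_lt_iff₀ (by positivity)] at hD0
    simp only [D]; push_cast
    nlinarith
  have hwin : ∀ᶠ k : ℕ in atTop, ∀ j ∈ Finset.range (M + 1), ∃ n, D * k < n ∧ n ≤ (D + 1) * k ∧
      Int.fract (x n) ∈ Set.Ico (2 * j * κ) ((2 * j + 1) * κ) := by
    rw [Filter.eventually_all_finset]
    intro j hj
    have hj' : (j : ℝ) ≤ M := by exact_mod_cast Nat.lt_succ_iff.1 (Finset.mem_range.1 hj)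
    exact window x hx D (by omega) _ _ (by positivity) (by nlinarith) (by nlinarith)
  obtain ⟨N0, hN0⟩ := eventually_atTop.1 (hy (κ / 4) (by positivity))
  obtain ⟨k, hk, hkN⟩ := (hwin.and (eventually_ge_atTop (N0 + 1))).exists
  choose! f hf1 hf2 hf3 using hk
  obtain ⟨i, hi, j, hj, hij, hfij⟩ := Finset.exists_ne_map_eq_of_card_lt_of_maps_to
    (s := Finset.range (M + 1)) (t := Finset.range M) (f := fun j => (f j - 1) % M) (by simp)
    (fun j _ => by simpa using Nat.mod_lt _ (by omega))
  have main : ∀ i j : ℕ, i ∈ Finset.range (M + 1) → j ∈ Finset.range (M + 1) → i < j →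
      (f i - 1) % M = (f j - 1) % M → False := by
    intro i j hi hj hij hfij
    have hk1 : 1 ≤ k := by omega
    have hDk : k ≤ D * k := Nat.le_mul_of_pos_left _ (by omega)
    have hL' : (f i - 1) % L = (f j - 1) % L := by
      have h1 : (f i - 1) ≡ (f j - 1) [MOD M] := hfij
      exact h1.of_mul_left _
    have hq : (f i - 1) ≡ (f j - 1) [MOD r.den] := by
      have h1 : (f i - 1) ≡ (f j - 1) [MOD M] := hfij
      exact h1.of_mul_right _
    have hfi := hf1 i hi
    have hfj := hf1 j hj
    have hyi := hN0 (f i) (by omega)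
    have hyj := hN0 (f j) (by omega)
    rw [hL'] at hyi
    have hlog : ∀ n m : ℕ, D * k < n → n ≤ (D + 1) * k → D * k < m → m ≤ (D + 1) * k →
        Real.log n - Real.log m ≤ 1 / D := by
      intro n m h1 h2 h3 h4
      have h5 : (0:ℝ) < D * k := by positivity
      have h1' : (D * k : ℝ) < n := by exact_mod_cast h1
      have h2' : (n : ℝ) ≤ (D + 1) * k := by exact_mod_cast h2
      have h3' : (D * k : ℝ) < m := by exact_mod_cast h3
      have hm : (0:ℝ) < m := h5.trans h3'
      have hn : (0:ℝ) < n := h5.trans h1'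
      have hDp : (0:ℝ) < D := by positivity
      rw [← Real.log_div hn.ne' hm.ne']
      refine (Real.log_le_sub_one_of_pos (by positivity)).trans ?_
      rw [div_sub_one hm.ne', div_le_div_iff₀ hm hDp]
      nlinarith
    have hl1 := hlog (f i) (f j) hfi (hf2 i hi) hfj (hf2 j hj)
    have hl2 := hlog (f j) (f i) hfj (hf2 j hj) hfi (hf2 i hi)
    have hl : |α * (Real.log (f j) - Real.log (f i))| < κ / 2 := by
      rw [abs_mul]
      refine lt_of_le_of_lt ?_ hD
      rw [div_eq_mul_one_div]
      gcongr
      rw [abs_le]; constructor <;> linarith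
    obtain ⟨m, hm⟩ : ∃ m : ℤ, ((f j : ℝ) - f i) * r = m := by
      obtain ⟨t, ht⟩ := (Nat.modEq_iff_dvd.1 hq)
      refine ⟨t * r.num, ?_⟩
      have h1 : ((f j : ℤ) - f i) = r.den * t := by
        rw [← ht]; push_cast [Nat.cast_sub (show 1 ≤ f i by omega), Nat.cast_sub (show 1 ≤ f j by omega)]; ring
      have h2 : ((f j : ℝ) - f i) = r.den * t := by exact_mod_cast h1
      have h3 : (r : ℝ) * r.den = r.num := by exact_mod_cast Rat.mul_den_eq_num r
      rw [h2]; push_cast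
      linear_combination (t : ℝ) * h3
    have e1 : x (f j) - x (f i) = m + α * (Real.log (f j) - Real.log (f i)) + (y (f j) - y (f i)) := by
      rw [← hm, hxdef]; ring
    have gi := hf3 i hi
    have gj := hf3 j hj
    have ei := Int.self_sub_floor (x (f i))
    have ej := Int.self_sub_floor (x (f j))
    obtain ⟨s, hs⟩ : ∃ s : ℤ, s = m - ⌊x (f j)⌋ + ⌊x (f i)⌋ := ⟨_, rfl⟩
    have hs' : (s : ℝ) = m - ⌊x (f j)⌋ + ⌊x (f i)⌋ := by rw [hs]; push_cast; ring
    have hij' : (i : ℝ) + 1 ≤ j := by exact_mod_cast hij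
    have hjM : (j : ℝ) ≤ M := by exact_mod_cast Nat.lt_succ_iff.1 (Finset.mem_range.1 hj)
    have hi0 : (0 : ℝ) ≤ i := Nat.cast_nonneg i
    have k1 : κ < Int.fract (x (f j)) - Int.fract (x (f i)) := by nlinarith [gi.2, gj.1]
    have k2 : Int.fract (x (f j)) - Int.fract (x (f i)) < 1 - κ := by nlinarith [gi.1, gj.2]
    rw [abs_lt] at hyi hyj hl
    have s0 : (0 : ℝ) < s := by linarith [hyi.1, hyi.2, hyj.1, hyj.2, hl.1, hl.2]
    have s1 : (s : ℝ) < 1 := by linarith [hyi.1, hyi.2, hyj.1, hyj.2, hl.1, hl.2]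
    have s0' : 0 < s := by exact_mod_cast s0
    have s1' : s < 1 := by exact_mod_cast s1
    omega
  rcases lt_or_gt_of_ne hij with h | h
  · exact main i j hi hj h hfij
  · exact main j i hj hi h hfij.symm

theorem ud_linear_log_iff_irrational (α ϑ : ℝ) (L : ℕ) (hL : 1 ≤ L) (y : ℕ → ℝ)
    (h : ∀ ℓ : ℕ, 1 ≤ ℓ → ℓ ≤ L →
      ∃ c : ℝ, Filter.Tendsto (fun n => y (n * L + ℓ)) Filter.atTop (nhds c)) :
    UDMod1 (fun n => (n : ℝ) * ϑ + α * Real.log n + y n) ↔ Irrational ϑ := by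
  choose! c hc using h
  have hy : ∀ ε > 0, ∀ᶠ n in atTop, |y n - c ((n - 1) % L + 1)| < ε := by
    intro ε hε
    apply residue_eventually L hL
    intro ℓ h1 h2
    filter_upwards [(Metric.tendsto_nhds.1 (hc ℓ h1 h2)) ε hε] with k hk
    have : (k * L + ℓ - 1) % L + 1 = ℓ := by
      rw [show k * L + ℓ - 1 = (ℓ - 1) + k * L by omega, Nat.add_mul_mod_self_right,
        Nat.mod_eq_of_lt (by omega)]
      omega
    rw [this]
    exact hk
  constructor
  · intro hx
    by_contra hr
    obtain ⟨r, rfl⟩ := not_not.1 hr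
    exact rat_dir α r L hL y (fun n => c (n + 1)) hy hx
  · refine irr_dir α ϑ L hL y ?_
    rw [Metric.tendsto_nhds]
    intro ε hε
    have h1 := hy (ε / 2) (by positivity)
    filter_upwards [h1, (tendsto_add_atTop_nat L).eventually h1, eventually_ge_atTop 1]
      with n hn hn' hn1
    have : (n + L - 1) % L = (n - 1) % L := by
      rw [show n + L - 1 = (n - 1) + L by omega, Nat.add_mod_right]
    rw [this] at hn'
    rw [abs_lt] at hn hn'
    rw [Real.dist_eq, sub_zero, abs_lt]
    constructor <;> linarith [hn.1, hn.2, hn'.1, hn'.2]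
end

section
/- Let b ≥ 2 be an integer and let Λ : ℝ/ℤ → ℝ/ℤ be the map t ↦ ⟨p t + β ln|u cos(2πt)|⟩ for fixed p ∈ ℤ and β, u ∈ ℝ. Then the pushforward of Haar measure on ℝ/ℤ under Λ equals Haar measure if and only if p ≠ 0 and βu = 0. -/
open MeasureTheory Set Complex

/-- The integrand `e^{2πi p s} |cos πs|^{ic}`. -/
noncomputable def auxH (c : ℝ) (p : ℤ) (s : ℝ) : ℂ :=
  cexp (((2 * Real.pi * p * s + c * Real.log |Real.cos (Real.pi * s)| : ℝ) : ℂ) * I)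

lemma auxH_norm (c : ℝ) (p : ℤ) (s : ℝ) : ‖auxH c p s‖ = 1 := by
  unfold auxH
  exact Complex.norm_exp_ofReal_mul_I _

lemma auxH_measurable (c : ℝ) (p : ℤ) : Measurable (auxH c p) := by
  unfold auxH
  have : Measurable fun s : ℝ => Real.log |Real.cos (Real.pi * s)| := by
    refine Real.measurable_log.comp ?_
    exact (by fun_prop : Continuous fun s : ℝ => |Real.cos (Real.pi * s)|).measurable
  fun_prop

lemma auxH_intervalIntegrable (c : ℝ) (p : ℤ) (a b : ℝ) :
    IntervalIntegrable (auxH c p) volume a b := by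
  refine (intervalIntegrable_const (c := (1 : ℝ))).mono_fun
    (auxH_measurable c p).aestronglyMeasurable ?_
  refine Filter.Eventually.of_forall fun x => ?_
  simp [auxH_norm]

lemma auxH_periodic (c : ℝ) (p : ℤ) : Function.Periodic (auxH c p) 1 := by
  intro s
  unfold auxH
  have h1 : Real.cos (Real.pi * (s + 1)) = - Real.cos (Real.pi * s) := by
    rw [mul_add, mul_one, Real.cos_add_pi]
  rw [h1, abs_neg]
  rw [Complex.exp_eq_exp_iff_exists_int]
  refine ⟨p, ?_⟩
  push_cast
  ring

lemma auxH_cpow (c : ℝ) (p : ℤ) {s : ℝ} (hs : 0 < Real.cos (Real.pi * s)) :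
    auxH c p s = cexp (2 * Real.pi * p * s * I) * (Real.cos (Real.pi * s) : ℂ) ^ ((c : ℂ) * I) := by
  unfold auxH
  rw [Complex.cpow_def_of_ne_zero (by exact_mod_cast hs.ne'), ← Complex.exp_add, abs_of_pos hs,
    Complex.ofReal_add, Complex.ofReal_mul c, Complex.ofReal_log hs.le]
  congr 1
  push_cast
  ring

lemma cos_pos_aux {s : ℝ} (hs : s ∈ Ioo (-(1/2) : ℝ) (1/2)) : 0 < Real.cos (Real.pi * s) := by
  apply Real.cos_pos_of_mem_Ioo
  constructor <;> nlinarith [Real.pi_pos, hs.1, hs.2]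

lemma auxH_rec (c : ℝ) (p : ℤ) :
    (2 * p + 2 + c * I) * ∫ s in (-(1/2) : ℝ)..(1/2), auxH c (p + 1) s
      = (c * I - 2 * p) * ∫ s in (-(1/2) : ℝ)..(1/2), auxH c p s := by
  have key := intervalIntegral.integral_eq_sub_of_hasDerivAt_of_le (a := (-(1/2) : ℝ)) (b := 1/2)
    (f := fun s : ℝ => cexp (Real.pi * (2 * p + 1) * I * s) *
      (Real.cos (Real.pi * s) : ℂ) ^ ((c : ℂ) * I + 1))
    (f' := fun s => (Real.pi * I / 2) * ((2 * p + 2 + c * I) * auxH c (p + 1) s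
      - (c * I - 2 * p) * auxH c p s)) (by norm_num) ?_ ?_ ?_
  · have e1 : Real.cos (Real.pi * (1/2)) = 0 := by
      rw [show Real.pi * (1/2) = Real.pi / 2 by ring]; exact Real.cos_pi_div_two
    have e2 : Real.cos (Real.pi * (-(1/2))) = 0 := by
      rw [mul_neg, Real.cos_neg, e1]
    have e3 : (c : ℂ) * I + 1 ≠ 0 := by
      intro h
      have := congrArg Complex.re h
      simp at this
    simp only [e1, e2, Complex.ofReal_zero, Complex.zero_cpow e3, mul_zero, sub_zero] at key
    rw [intervalIntegral.integral_const_mul, intervalIntegral.integral_sub,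
      intervalIntegral.integral_const_mul, intervalIntegral.integral_const_mul] at key
    · have h0 : (Real.pi : ℂ) * I / 2 ≠ 0 := by
        simp [Real.pi_ne_zero]
      exact sub_eq_zero.mp ((mul_eq_zero.mp key).resolve_left h0)
    · exact (auxH_intervalIntegrable _ _ _ _).const_mul _
    · exact (auxH_intervalIntegrable _ _ _ _).const_mul _
  · apply Continuous.continuousOn
    refine Continuous.mul (by fun_prop) ?_
    exact (Complex.continuous_ofReal_cpow_const (by simp)).comp
      (by fun_prop : Continuous fun s : ℝ => Real.cos (Real.pi * s))
  · intro s hs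
    have hc := cos_pos_aux hs
    have e3 : (c : ℂ) * I + 1 ≠ 0 := by
      intro h
      have := congrArg Complex.re h
      simp at this
    have d1 : HasDerivAt (fun s : ℝ => Real.cos (Real.pi * s))
        (-Real.sin (Real.pi * s) * Real.pi) s := by
      simpa using ((hasDerivAt_id s).const_mul Real.pi).cos
    have d2 := (hasDerivAt_ofReal_cpow_const hc.ne' e3).scomp s d1
    have d3 : HasDerivAt (fun s : ℝ => cexp (Real.pi * (2 * p + 1) * I * s))
        (cexp (Real.pi * (2 * p + 1) * I * s) * (Real.pi * (2 * p + 1) * I)) s := by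
      have := (((hasDerivAt_id (s : ℂ)).const_mul (Real.pi * (2 * p + 1) * I : ℂ)).cexp).comp_ofReal
      simpa using this
    refine (d3.mul d2).congr_deriv ?_
    simp only [Function.comp_apply, Complex.real_smul]
    rw [auxH_cpow c p hc, auxH_cpow c (p+1) hc, add_sub_cancel_right,
      Complex.cpow_add _ _ (by exact_mod_cast hc.ne'), Complex.cpow_one]
    generalize (Real.cos (Real.pi * s) : ℂ) ^ ((c : ℂ) * I) = W
    have hcos : (Real.cos (Real.pi * s) : ℂ) =
        (cexp (Real.pi * s * I) + cexp (- (Real.pi * s * I))) / 2 := by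
      push_cast; rw [Complex.cos]; ring_nf
    have hsin : (Real.sin (Real.pi * s) : ℂ) =
        (cexp (- (Real.pi * s * I)) - cexp (Real.pi * s * I)) * I / 2 := by
      push_cast; rw [Complex.sin]; ring_nf
    have x1 : cexp (Real.pi * (2 * p + 1) * I * s)
        = cexp (2 * Real.pi * p * s * I) * cexp (Real.pi * s * I) := by
      rw [← Complex.exp_add]; ring_nf
    have x2 : cexp (2 * Real.pi * ((p + 1 : ℤ) : ℂ) * s * I)
        = cexp (2 * Real.pi * p * s * I) * cexp (Real.pi * s * I) * cexp (Real.pi * s * I) := by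
      rw [← Complex.exp_add, ← Complex.exp_add]; push_cast; ring_nf
    have x3 : cexp (Real.pi * s * I) * cexp (- (Real.pi * s * I)) = 1 := by
      rw [← Complex.exp_add]; simp
    push_cast at hcos hsin x2 ⊢
    rw [x1, x2, hcos, hsin]
    generalize cexp (Real.pi * s * I) = E at *
    generalize cexp (-(Real.pi * s * I)) = F at *
    generalize cexp (2 * Real.pi * p * s * I) = P at *
    linear_combination (Real.pi * P * W * I / 2 * (2 * p - c * I)) * x3
  · exact (((auxH_intervalIntegrable _ _ _ _).const_mul _).sub
      ((auxH_intervalIntegrable _ _ _ _).const_mul _)).const_mul _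

lemma auxH_ne (c : ℝ) (hc : c ≠ 0) (p : ℤ) :
    ∫ s in (-(1/2) : ℝ)..(1/2), auxH c p s ≠ 0 := by
  intro h
  have hne : ∀ a : ℝ, (a : ℂ) + c * I ≠ 0 := by
    intro a ha
    have := congrArg Complex.im ha
    simp at this
    exact hc this
  have all : ∀ n : ℤ, ∫ s in (-(1/2) : ℝ)..(1/2), auxH c n s = 0 := by
    intro n
    induction n using Int.inductionOn' (b := p) with
    | zero => exact h
    | succ k _ ih =>
      have := auxH_rec c k
      rw [ih, mul_zero] at this
      refine (mul_eq_zero.mp this).resolve_left ?_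
      have := hne (2 * k + 2)
      push_cast at this
      exact this
    | pred k _ ih =>
      have := auxH_rec c (k - 1)
      rw [sub_add_cancel, ih, mul_zero] at this
      refine (mul_eq_zero.mp this.symm).resolve_left ?_
      have := hne (-(2 * (k - 1)))
      push_cast at this ⊢
      intro h'
      apply this
      rw [← h']; ring
  have hab : (-(1/2) : ℝ) < 1/2 := by norm_num
  have pars := tsum_sq_fourierCoeffOn (f := auxH c 0) hab ?_
  · have z : ∀ i : ℤ, fourierCoeffOn hab (auxH c 0) i = 0 := by
      intro i
      rw [fourierCoeffOn_eq_integral]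
      have : ∀ x : ℝ, (fourier (-i) (x : AddCircle ((1/2 : ℝ) - -(1/2)))) • auxH c 0 x
          = auxH c (-i) x := by
        intro x
        rw [fourier_coe_apply]
        unfold auxH
        rw [smul_eq_mul, ← Complex.exp_add]
        congr 1
        push_cast
        norm_num
        ring
      simp_rw [this, all]
      simp
    simp only [z, auxH_norm] at pars
    norm_num at pars
  · refine MemLp.of_bound (C := 1) (auxH_measurable c 0).aestronglyMeasurable ?_
    exact Filter.Eventually.of_forall fun x => (auxH_norm c 0 x).le

lemma auxH_two (c : ℝ) (p : ℤ) :
    ∫ t in Ico (0 : ℝ) 1, auxH c p (2 * t) = ∫ s in (-(1/2) : ℝ)..(1/2), auxH c p s := by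
  rw [integral_Ico_eq_integral_Ioc, ← intervalIntegral.integral_of_le zero_le_one,
    intervalIntegral.integral_comp_mul_left (auxH c p) (two_ne_zero),
    ← intervalIntegral.integral_add_adjacent_intervals (b := (1 : ℝ))
      (auxH_intervalIntegrable _ _ _ _) (auxH_intervalIntegrable _ _ _ _)]
  have h1 := (auxH_periodic c p).intervalIntegral_add_eq (2 * 0) (-(1/2))
  have h2 := (auxH_periodic c p).intervalIntegral_add_eq 1 (-(1/2))
  norm_num at h1 h2 ⊢
  rw [h1, h2]
  ring

lemma map_meas (p : ℤ) (β u : ℝ) : Measurable (fun t : ℝ =>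
    (((p : ℝ) * t + β * Real.log |u * Real.cos (2 * Real.pi * t)| : ℝ) : UnitAddCircle)) := by
  refine AddCircle.measurable_mk'.comp ?_
  have : Measurable fun t : ℝ => Real.log |u * Real.cos (2 * Real.pi * t)| := by
    refine Real.measurable_log.comp ?_
    exact (by fun_prop : Continuous fun s : ℝ => |u * Real.cos (2 * Real.pi * s)|).measurable
  fun_prop

lemma integral_fourier_two : ∫ x : UnitAddCircle, fourier 2 x = 0 := by
  have h := fourierCoeff_fourier (T := 1) 2
  have h0 := congrFun h 0
  rw [fourierCoeff] at h0
  rw [AddCircle.integral_haarAddCircle] at h0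
  simpa using h0

theorem map_haar_eq_haar_iff (p : ℤ) (β u : ℝ) :
    MeasureTheory.Measure.map
        (fun t : ℝ =>
          (((p : ℝ) * t + β * Real.log |u * Real.cos (2 * Real.pi * t)| : ℝ) : UnitAddCircle))
        (MeasureTheory.volume.restrict (Set.Ico (0 : ℝ) 1))
      = MeasureTheory.volume ↔ p ≠ 0 ∧ β * u = 0 := by
  have hz : β * u = 0 → ∀ t : ℝ, β * Real.log |u * Real.cos (2 * Real.pi * t)| = 0 := by
    intro h t
    rcases mul_eq_zero.mp h with h | h <;> simp [h]
  constructor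
  · intro h
    have hF : ∫ t in Ico (0 : ℝ) 1, fourier 2
        (((p : ℝ) * t + β * Real.log |u * Real.cos (2 * Real.pi * t)| : ℝ) : UnitAddCircle) = 0 := by
      rw [← integral_fourier_two, ← h, integral_map (map_meas p β u).aemeasurable
        (ContinuousMap.continuous _).aestronglyMeasurable]
    have hbu : β * u = 0 := by
      by_contra hbu
      have hb : β ≠ 0 := left_ne_zero_of_mul hbu
      have hu : u ≠ 0 := right_ne_zero_of_mul hbu
      have hc : 4 * Real.pi * β ≠ 0 := by
        simp [Real.pi_ne_zero, hb]
      have hpi := Real.pi_pos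
      apply auxH_ne (4 * Real.pi * β) hc p
      rw [← auxH_two]
      have hae : ∀ᵐ t : ℝ ∂(volume.restrict (Ico (0 : ℝ) 1)),
          Real.cos (2 * Real.pi * t) ≠ 0 := by
        apply ae_restrict_of_ae
        have : Set.Countable {t : ℝ | Real.cos (2 * Real.pi * t) = 0} := by
          have : {t : ℝ | Real.cos (2 * Real.pi * t) = 0} ⊆
              range (fun k : ℤ => (2 * (k : ℝ) + 1) / 4) := by
            intro t ht
            obtain ⟨k, hk⟩ := Real.cos_eq_zero_iff.mp ht
            refine ⟨k, ?_⟩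
            have : Real.pi * (4 * t - (2 * k + 1)) = 0 := by linarith
            have := (mul_eq_zero.mp this).resolve_left hpi.ne'
            simp only
            linarith
          exact (countable_range _).mono this
        rw [ae_iff]
        simpa using this.measure_zero volume
      have e : ∫ t in Ico (0 : ℝ) 1, fourier 2
          (((p : ℝ) * t + β * Real.log |u * Real.cos (2 * Real.pi * t)| : ℝ) : UnitAddCircle)
          = ∫ t in Ico (0 : ℝ) 1, cexp (4 * Real.pi * β * Real.log |u| * I) *
            auxH (4 * Real.pi * β) p (2 * t) := by
        apply integral_congr_ae
        filter_upwards [hae] with t ht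
        rw [fourier_coe_apply]
        unfold auxH
        rw [← Complex.exp_add, abs_mul, Real.log_mul (abs_ne_zero.mpr hu) (abs_ne_zero.mpr ht),
          show Real.pi * (2 * t) = 2 * Real.pi * t by ring]
        congr 1
        push_cast
        ring
      rw [e, integral_const_mul] at hF
      exact (mul_eq_zero.mp hF).resolve_left (Complex.exp_ne_zero _)
    refine ⟨?_, hbu⟩
    rintro rfl
    simp only [hz hbu] at hF
    simp at hF
  · rintro ⟨hp, hbu⟩
    have h1 : (fun t : ℝ =>
        (((p : ℝ) * t + β * Real.log |u * Real.cos (2 * Real.pi * t)| : ℝ) : UnitAddCircle))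
        = (fun g : UnitAddCircle => p • g) ∘ (fun t : ℝ => (t : UnitAddCircle)) := by
      funext t
      rw [hz hbu t, add_zero, Function.comp_apply, ← AddCircle.coe_zsmul, zsmul_eq_mul]
    have m1 := AddCircle.measurePreserving_mk 1 0
    have m2 := Measure.measurePreserving_zsmul (volume : Measure UnitAddCircle) hp
    rw [h1, restrict_Ico_eq_restrict_Ioc]
    have := (m2.comp m1).map_eq
    rwa [zero_add] at this
end

section
/- Let φ = (1+√5)/2 be the golden ratio and b ≥ 2 an integer. Then log_b φ is irrational. Consequently, the sequence (log_b F_n) of base-b logarithms of the Fibonacci numbers is uniformly distributed mod 1, i.e., the Fibonacci sequence is b-Benford. -/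
open scoped Classical

/-- The base-`b` significand of `x`, with `signif b 0 = 0`. -/
noncomputable def signif (b : ℕ) (x : ℝ) : ℝ :=
  if x = 0 then 0 else (b : ℝ) ^ (Real.logb b |x| - (⌊Real.logb b |x|⌋ : ℝ))

/-- A real sequence is `b`-Benford. -/
def IsBenford (b : ℕ) (x : ℕ → ℝ) : Prop :=
  ∀ s : ℝ, 1 ≤ s → s < b →
    Filter.Tendsto
      (fun N : ℕ => (((Finset.Icc 1 N).filter fun n => signif b (x n) ≤ s).card : ℝ) / N)
      Filter.atTop (nhds (Real.logb b s))

open MeasureTheory Filter Topology in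
/-- Weyl sums: if increments converge to an irrational, averages of nontrivial characters vanish. -/
lemma weyl_sum (x : ℕ → ℝ) (θ : ℝ) (hθ : Irrational θ)
    (hx : Tendsto (fun n => x (n + 1) - x n) atTop (𝓝 θ)) (k : ℤ) (hk : k ≠ 0) :
    Tendsto (fun N : ℕ => (N : ℝ)⁻¹ • ∑ n ∈ Finset.range N,
      (fourier k ((x n : ℝ) : UnitAddCircle) : ℂ)) atTop (𝓝 0) := by
  set z : ℕ → ℂ := fun n => fourier k ((x n : ℝ) : UnitAddCircle) with hz
  set w : ℂ := fourier k ((θ : ℝ) : UnitAddCircle) with hw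
  have hnorm : ∀ n, ‖z n‖ = 1 := fun n => Circle.norm_coe _
  have hw1 : 1 - w ≠ 0 := by
    intro h
    have h1 : w = 1 := (sub_eq_zero.mp h).symm
    rw [hw, fourier_coe_apply, Complex.exp_eq_one_iff] at h1
    obtain ⟨m, hm⟩ := h1
    have hpi : (2 * (Real.pi : ℂ) * Complex.I) ≠ 0 := Complex.two_pi_I_ne_zero
    have h2 : (k : ℂ) * (θ : ℂ) = m := by
      apply mul_left_cancel₀ hpi
      rw [← mul_comm (m : ℂ), ← hm]
      push_cast
      ring
    have h3 : (k : ℝ) * θ = m := by exact_mod_cast h2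
    exact (hθ.intCast_mul hk).ne_int m h3
  have hdiff : Tendsto (fun n => z (n + 1) - w * z n) atTop (𝓝 0) := by
    have hc : Tendsto (fun n => (fourier k (((x (n + 1) - x n : ℝ)) : UnitAddCircle) : ℂ) - w)
        atTop (𝓝 0) := by
      have hcont : Continuous fun t : ℝ => (fourier k (t : UnitAddCircle) : ℂ) :=
        (fourier k).continuous.comp (AddCircle.continuous_mk' 1)
      have := (hcont.tendsto θ).comp hx
      have h5 := this.sub_const w
      rw [show (fourier k (θ : UnitAddCircle) : ℂ) - w = 0 from sub_self _] at h5
      exact h5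
    rw [tendsto_zero_iff_norm_tendsto_zero] at hc ⊢
    refine hc.congr fun n => ?_
    have : z (n + 1) - w * z n =
        ((fourier k (((x (n + 1) - x n : ℝ)) : UnitAddCircle) : ℂ) - w) * z n := by
      rw [sub_mul, hz]
      congr 1
      simp only [fourier_coe_apply]
      rw [← Complex.exp_add]
      congr 1
      push_cast
      ring
    rw [this, norm_mul, hnorm, mul_one]
  have hces := hdiff.cesaro_smul
  have hbd : Tendsto (fun N : ℕ => (N : ℝ)⁻¹ • (z N - z 0)) atTop (𝓝 0) := by
    rw [tendsto_zero_iff_norm_tendsto_zero]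
    refine squeeze_zero (g := fun N : ℕ => (N : ℝ)⁻¹ * 2) (fun _ => norm_nonneg _) (fun N => ?_) ?_
    · rw [norm_smul, norm_inv, Real.norm_natCast]
      gcongr
      refine (norm_sub_le _ _).trans ?_
      rw [hnorm, hnorm]; norm_num
    · simpa using (tendsto_inv_atTop_nhds_zero_nat (𝕜 := ℝ)).mul_const 2
  have h := (hces.sub hbd).const_mul (1 - w)⁻¹
  simp only [sub_zero, mul_zero] at h
  refine h.congr fun N => ?_
  have hs : ∑ i ∈ Finset.range N, (z (i + 1) - w * z i) - (z N - z 0)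
      = (1 - w) * ∑ i ∈ Finset.range N, z i := by
    rw [← Finset.sum_range_sub z N, ← Finset.sum_sub_distrib, Finset.mul_sum]
    refine Finset.sum_congr rfl fun i _ => ?_
    ring
  rw [← smul_sub, hs, mul_smul_comm, inv_mul_cancel_left₀ hw1]

open MeasureTheory Filter Topology in
/-- Convergence of all Fourier coefficients implies weak convergence. -/
lemma weak_of_fourier (μs : ℕ → ProbabilityMeasure UnitAddCircle)
    (μ : ProbabilityMeasure UnitAddCircle)
    (h : ∀ k : ℤ, Tendsto (fun N => ∫ t, (fourier k t : ℂ) ∂(μs N : Measure UnitAddCircle)) atTop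
      (𝓝 (∫ t, (fourier k t : ℂ) ∂(μ : Measure UnitAddCircle)))) :
    Tendsto μs atTop (𝓝 μ) := by
  have hIntegr : ∀ (ν : ProbabilityMeasure UnitAddCircle) (f : C(UnitAddCircle, ℂ)),
      Integrable f (ν : Measure UnitAddCircle) := fun ν f =>
    f.continuous.integrable_of_hasCompactSupport (HasCompactSupport.of_compactSpace f)
  have hspan : ∀ f ∈ Submodule.span ℂ (Set.range (@fourier (1 : ℝ))),
      Tendsto (fun N => ∫ t, f t ∂(μs N : Measure UnitAddCircle)) atTop
      (𝓝 (∫ t, f t ∂(μ : Measure UnitAddCircle))) := by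
    intro f hf
    induction hf using Submodule.span_induction with
    | mem f hf => obtain ⟨k, rfl⟩ := hf; exact h k
    | zero => simp
    | add f g _ _ hf hg =>
      have := hf.add hg
      simp only [ContinuousMap.add_apply]
      rw [integral_add (hIntegr _ _) (hIntegr _ _)]
      refine this.congr fun N => ?_
      rw [integral_add (hIntegr _ _) (hIntegr _ _)]
    | smul c f _ hf =>
      simp only [ContinuousMap.smul_apply, integral_smul]
      exact hf.const_smul c
  rw [ProbabilityMeasure.tendsto_iff_forall_integral_rclike_tendsto ℂ]
  intro f
  set F : C(UnitAddCircle, ℂ) := f.toContinuousMap with hF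
  have hFcl : F ∈ closure (Submodule.span ℂ (Set.range (@fourier (1 : ℝ))) : Set _) := by
    have h1 : F ∈ (Submodule.span ℂ (Set.range (@fourier (1 : ℝ)))).topologicalClosure := by
      rw [span_fourier_closure_eq_top]; trivial
    exact h1
  have key : ∀ (ν : ProbabilityMeasure UnitAddCircle) (g : C(UnitAddCircle, ℂ)),
      ‖∫ t, f t ∂(ν : Measure UnitAddCircle) - ∫ t, g t ∂(ν : Measure UnitAddCircle)‖
        ≤ ‖F - g‖ := by
    intro ν g
    have e : ∫ t, f t ∂(ν : Measure UnitAddCircle) = ∫ t, F t ∂(ν : Measure UnitAddCircle) := rfl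
    rw [e, ← integral_sub (hIntegr ν F) (hIntegr ν g)]
    refine (norm_integral_le_of_norm_le_const (C := ‖F - g‖) (ae_of_all _ fun t => ?_)).trans ?_
    · exact (F - g).norm_coe_le_norm t
    · simp
  rw [Metric.tendsto_atTop]
  intro ε hε
  obtain ⟨g, hg, hgF⟩ := Metric.mem_closure_iff.mp hFcl (ε / 3) (by positivity)
  obtain ⟨N0, hN0⟩ := Metric.tendsto_atTop.mp (hspan g hg) (ε / 3) (by positivity)
  refine ⟨N0, fun N hN => ?_⟩
  have h1 := key (μs N) g
  have h2 := key μ g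
  have h3 := hN0 N hN
  rw [dist_eq_norm] at hgF
  rw [← dist_eq_norm] at h1 h2
  rw [dist_comm] at h2
  have t1 := dist_triangle4 (∫ t, f t ∂(μs N : Measure UnitAddCircle))
    (∫ t, g t ∂(μs N : Measure UnitAddCircle)) (∫ t, g t ∂(μ : Measure UnitAddCircle))
    (∫ t, f t ∂(μ : Measure UnitAddCircle))
  linarith

lemma mem_image_circle (S : Set ℝ) (hS : S ⊆ Set.Ico 0 1) (x : ℝ) :
    (x : UnitAddCircle) ∈ ((fun t : ℝ => (t : UnitAddCircle)) '' S) ↔ Int.fract x ∈ S := by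
  constructor
  · rintro ⟨y, hy, hyx⟩
    have hyx' : (y : UnitAddCircle) = x := hyx
    have h1 : Int.fract y = y := Int.fract_eq_self.mpr (hS hy)
    have h2 : Int.fract x = Int.fract y := by
      rw [eq_comm, QuotientAddGroup.eq, AddSubgroup.mem_zmultiples_iff] at hyx'
      obtain ⟨m, hm⟩ := hyx'
      rw [Int.fract_eq_fract]
      refine ⟨-m, ?_⟩
      simp only [zsmul_eq_mul, mul_one] at hm
      push_cast
      linarith
    rw [h2, h1]; exact hy
  · intro h
    refine ⟨_, h, ?_⟩
    have : (Int.fract x : ℝ) = x - ⌊x⌋ := rfl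
    show ((Int.fract x : ℝ) : UnitAddCircle) = x
    rw [eq_comm, QuotientAddGroup.eq, AddSubgroup.mem_zmultiples_iff]
    exact ⟨-⌊x⌋, by rw [this, zsmul_eq_mul]; push_cast; ring⟩

open MeasureTheory Filter Topology in
lemma equidist (x : ℕ → ℝ) (θ : ℝ) (hθ : Irrational θ)
    (hx : Tendsto (fun n => x (n + 1) - x n) atTop (𝓝 θ)) (S : Set ℝ) (a c : ℝ) (hac : a ≤ c)
    (hS : S ⊆ Set.Ico 0 1) (h1 : Set.Ioo a c ⊆ S) (h2 : S ⊆ Set.Icc a c) :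
    Tendsto (fun N : ℕ => (N : ℝ)⁻¹ * ∑ n ∈ Finset.range N,
      S.indicator (fun _ => (1 : ℝ)) (Int.fract (x n))) atTop (𝓝 (c - a)) := by
  have hprob : ∀ N : ℕ, IsProbabilityMeasure (((N + 1 : ℕ) : ENNReal)⁻¹ •
      ∑ n ∈ Finset.range (N + 1), Measure.dirac ((x n : ℝ) : UnitAddCircle)) := fun N => ⟨by
    simp only [Measure.smul_apply, Measure.finsetSum_apply, measure_univ, smul_eq_mul]
    simp only [Finset.sum_const, Finset.card_range, nsmul_eq_mul, mul_one]
    exact ENNReal.inv_mul_cancel (by simp) (ENNReal.natCast_ne_top _)⟩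
  have hvol : IsProbabilityMeasure (volume : Measure UnitAddCircle) := ⟨UnitAddCircle.measure_univ⟩
  let μs : ℕ → ProbabilityMeasure UnitAddCircle := fun N => ⟨_, hprob N⟩
  let μ : ProbabilityMeasure UnitAddCircle := ⟨volume, hvol⟩
  have hμs : Tendsto μs atTop (𝓝 μ) := by
    apply weak_of_fourier
    intro k
    have e : ∀ N, ∫ t, (fourier k t : ℂ) ∂(μs N : Measure UnitAddCircle) =
        ((N + 1 : ℕ) : ℝ)⁻¹ • ∑ n ∈ Finset.range (N + 1),
          (fourier k ((x n : ℝ) : UnitAddCircle) : ℂ) := by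
      intro N
      show ∫ t, (fourier k t : ℂ) ∂(((N + 1 : ℕ) : ENNReal)⁻¹ •
        ∑ n ∈ Finset.range (N + 1), Measure.dirac ((x n : ℝ) : UnitAddCircle)) = _
      rw [integral_smul_measure, integral_finsetSum_measure]
      · simp only [integral_dirac]
        rw [ENNReal.toReal_inv, ENNReal.toReal_natCast]
      · intro i _
        exact (fourier k).continuous.integrable_of_hasCompactSupport
          (HasCompactSupport.of_compactSpace _)
    simp only [e]
    by_cases hk : k = 0
    · subst hk
      have e2 : ∫ t, (fourier 0 t : ℂ) ∂(μ : Measure UnitAddCircle) = 1 := by simp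
      rw [e2]
      refine tendsto_const_nhds.congr fun N => ?_
      simp only [fourier_zero, Finset.sum_const, Finset.card_range]
      have h6 : ((N + 1 : ℕ) : ℂ) ≠ 0 := by exact_mod_cast Nat.succ_ne_zero N
      rw [Complex.real_smul, nsmul_eq_mul, mul_one, Complex.ofReal_inv, Complex.ofReal_natCast,
        inv_mul_cancel₀ h6]
    · have e2 : ∫ t, (fourier k t : ℂ) ∂(μ : Measure UnitAddCircle) = 0 := by
        have h3 := congrFun (fourierCoeff_fourier (T := 1) k) 0
        rw [Pi.single_apply, if_neg (Ne.symm hk)] at h3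
        rw [fourierCoeff, AddCircle.integral_haarAddCircle] at h3
        simp only [neg_zero, fourier_zero, one_smul, inv_one] at h3
        exact h3
      rw [e2]
      exact (tendsto_add_atTop_iff_nat 1).mpr (weyl_sum x θ hθ hx k hk)
  set q : ℝ → UnitAddCircle := fun t : ℝ => (t : UnitAddCircle) with hq
  have hqc : Continuous q := AddCircle.continuous_mk' 1
  have hfr : frontier (q '' S) ⊆ {q a, q c} := by
    have hcl : closure (q '' S) ⊆ q '' Set.Icc a c :=
      closure_minimal (Set.image_mono h2) (isCompact_Icc.image hqc).isClosed
    have hin : q '' Set.Ioo a c ⊆ interior (q '' S) :=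
      interior_maximal (Set.image_mono h1) (QuotientAddGroup.isOpenMap_coe _ isOpen_Ioo)
    rintro y ⟨hy1, hy2⟩
    obtain ⟨t, ht, rfl⟩ := hcl hy1
    rcases eq_or_lt_of_le ht.1 with h | h
    · left; rw [h]
    rcases eq_or_lt_of_le ht.2 with h' | h'
    · right; rw [h']; rfl
    exact absurd (hin ⟨t, ⟨h, h'⟩, rfl⟩) hy2
  have hpt : ∀ y : UnitAddCircle, volume ({y} : Set UnitAddCircle) = 0 := by
    intro y
    have := AddCircle.volume_closedBall (T := 1) (x := y) 0
    simpa using this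
  have hfr0 : (μ : Measure UnitAddCircle) (frontier (q '' S)) = 0 := by
    refine measure_mono_null hfr ?_
    rw [Set.insert_eq]
    exact measure_union_null (hpt _) (hpt _)
  have hSm : MeasurableSet S := by
    have : S = Set.Ioo a c ∪ (S ∩ {a, c}) := by
      ext t
      constructor
      · intro ht
        have := h2 ht
        rcases eq_or_lt_of_le this.1 with h | h
        · right; exact ⟨ht, Or.inl h.symm⟩
        rcases eq_or_lt_of_le this.2 with h' | h'
        · right; exact ⟨ht, Or.inr h'⟩
        · left; exact ⟨h, h'⟩
      · rintro (h | h)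
        · exact h1 h
        · exact h.1
    rw [this]
    exact measurableSet_Ioo.union ((Set.Finite.inter_of_right (Set.toFinite _) _).measurableSet)
  have hpre : q ⁻¹' (q '' S) = Int.fract ⁻¹' S := by
    ext t; exact mem_image_circle S hS t
  have hEm : NullMeasurableSet (q '' S) (volume : Measure UnitAddCircle) := by
    refine (nullMeasurableSet_of_null_frontier hfr0)
  have hSvol : volume S = ENNReal.ofReal (c - a) := by
    apply le_antisymm
    · rw [← Real.volume_Icc]; exact measure_mono h2
    · rw [← Real.volume_Ioo]; exact measure_mono h1
  have hEvol : (μ : Measure UnitAddCircle) (q '' S) = ENNReal.ofReal (c - a) := by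
    have hmp := UnitAddCircle.measurePreserving_mk 0
    have h4 := hmp.measure_preimage hEm
    show volume (q '' S) = _
    rw [← h4]
    change (volume.restrict (Set.Ioc 0 (0 + 1))) (q ⁻¹' (q '' S)) = _
    rw [hpre, zero_add, ← restrict_Ico_eq_restrict_Ioc, Measure.restrict_apply' measurableSet_Ico,
      ← hSvol]
    congr 1
    ext t
    constructor
    · rintro ⟨ht, ht'⟩
      have : Int.fract t = t := Int.fract_eq_self.mpr ht'
      rw [← this]; exact ht
    · intro ht
      have : Int.fract t = t := Int.fract_eq_self.mpr (hS ht)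
      exact ⟨by rw [Set.mem_preimage, this]; exact ht, hS ht⟩
  have hlim := ProbabilityMeasure.tendsto_measure_of_null_frontier_of_tendsto' hμs hfr0
  rw [hEvol] at hlim
  have hlim2 := (ENNReal.tendsto_toReal ENNReal.ofReal_ne_top).comp hlim
  rw [ENNReal.toReal_ofReal (by linarith)] at hlim2
  rw [← tendsto_add_atTop_iff_nat 1]
  refine hlim2.congr fun N => ?_
  show ENNReal.toReal ((((N + 1 : ℕ) : ENNReal)⁻¹ •
        ∑ n ∈ Finset.range (N + 1), Measure.dirac ((x n : ℝ) : UnitAddCircle)) (q '' S)) = _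
  rw [Measure.smul_apply, Measure.finsetSum_apply, smul_eq_mul, ENNReal.toReal_mul,
    ENNReal.toReal_sum (fun _ _ => measure_ne_top _ _)]
  congr 1
  · rw [ENNReal.toReal_inv, ENNReal.toReal_natCast]
  · refine Finset.sum_congr rfl fun n _ => ?_
    rw [Measure.dirac_apply]
    have := mem_image_circle S hS (x n)
    by_cases hm : Int.fract (x n) ∈ S
    · rw [Set.indicator_of_mem hm, Set.indicator_of_mem (this.mpr hm)]; simp
    · rw [Set.indicator_of_notMem hm, Set.indicator_of_notMem (fun h => hm (this.mp h))]; simp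

lemma golden_irr (b : ℕ) (hb : 2 ≤ b) : Irrational (Real.logb b ((1 + Real.sqrt 5) / 2)) := by
  change Irrational (Real.logb b Real.goldenRatio)
  rintro ⟨r, hr⟩
  have hb1 : (1 : ℝ) < b := by exact_mod_cast hb
  have hpos : 0 < Real.logb b Real.goldenRatio := Real.logb_pos hb1 Real.one_lt_goldenRatio
  have hrpos : 0 < r := by rw [← hr] at hpos; exact_mod_cast hpos
  have hnum : 0 ≤ r.num := (Rat.num_pos.mpr hrpos).le
  obtain ⟨p, hp⟩ := Int.eq_ofNat_of_zero_le hnum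
  obtain ⟨d, hd⟩ := Nat.exists_eq_succ_of_ne_zero r.den_nz
  have h1 : (r.den : ℝ) * Real.logb b Real.goldenRatio = p := by
    rw [← hr]
    have : (r.den : ℚ) * r = p := by
      rw [mul_comm, Rat.mul_den_eq_num, hp]; rfl
    exact_mod_cast this
  have h2 : Real.goldenRatio ^ (d + 1) = (b : ℝ) ^ p := by
    have h3 := Real.rpow_logb (by linarith : (0 : ℝ) < b) hb1.ne' Real.goldenRatio_pos
    rw [← Real.rpow_natCast (b : ℝ) p, ← h1, hd, mul_comm, Real.rpow_mul (by linarith), h3,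
      Real.rpow_natCast]
  rw [← Real.goldenRatio_mul_fib_succ_add_fib] at h2
  have hf : Nat.fib (d + 1) ≠ 0 := (Nat.fib_pos.mpr (Nat.succ_pos d)).ne'
  have h5 := (Real.goldenRatio_irrational.mul_natCast hf).add_natCast (Nat.fib d)
  rw [h2] at h5
  exact h5.ne_nat (b ^ p) (by push_cast; rfl)

open Filter Topology in
lemma fib_incr (b : ℕ) :
    Tendsto (fun n : ℕ => Real.logb b (Nat.fib (n + 1 + 1)) - Real.logb b (Nat.fib (n + 1)))
      atTop (𝓝 (Real.logb b ((1 + Real.sqrt 5) / 2))) := by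
  have h := (tendsto_add_atTop_iff_nat 1).mpr tendsto_fib_succ_div_fib_atTop
  have h2 := (h.log Real.goldenRatio_ne_zero).div_const (Real.log b)
  refine h2.congr fun n => ?_
  have p1 : (Nat.fib (n + 1 + 1) : ℝ) ≠ 0 := by
    exact_mod_cast (Nat.fib_pos.mpr (Nat.succ_pos _)).ne'
  have p2 : (Nat.fib (n + 1) : ℝ) ≠ 0 := by
    exact_mod_cast (Nat.fib_pos.mpr (Nat.succ_pos _)).ne'
  rw [Real.log_div p1 p2, sub_div]
  rfl

open Filter Topology in
lemma count_tendsto (b : ℕ) (hb : 2 ≤ b) (P : ℕ → Prop) [DecidablePred P] (S : Set ℝ) (a c : ℝ)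
    (hac : a ≤ c) (hS : S ⊆ Set.Ico 0 1) (h1 : Set.Ioo a c ⊆ S) (h2 : S ⊆ Set.Icc a c)
    (hP : ∀ n, P (n + 1) ↔ Int.fract (Real.logb b (Nat.fib (n + 1))) ∈ S) :
    Tendsto (fun N : ℕ => (((Finset.Icc 1 N).filter P).card : ℝ) / N) atTop (𝓝 (c - a)) := by
  have h := equidist (fun n => Real.logb b (Nat.fib (n + 1))) _ (golden_irr b hb) (fib_incr b)
    S a c hac hS h1 h2
  refine h.congr fun N => ?_
  rw [div_eq_inv_mul]
  congr 1
  rw [Finset.card_filter, Nat.cast_sum, Finset.range_eq_Ico,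
    ← Finset.Ico_add_one_right_eq_Icc, ← Finset.sum_Ico_add' _ 0 N 1]
  refine Finset.sum_congr rfl fun n _ => ?_
  by_cases hn : P (n + 1)
  · rw [Set.indicator_of_mem ((hP n).mp hn), if_pos hn]; simp
  · rw [Set.indicator_of_notMem (fun h => hn ((hP n).mpr h)), if_neg hn]; simp

theorem fibonacci_benford (b : ℕ) (hb : 2 ≤ b) :
    Irrational (Real.logb b ((1 + Real.sqrt 5) / 2)) ∧
    UDMod1 (fun n => Real.logb b ((Nat.fib n : ℝ))) ∧
    IsBenford b (fun n => (Nat.fib n : ℝ)) := by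
  have hb1 : (1 : ℝ) < b := by exact_mod_cast hb
  refine ⟨golden_irr b hb, ?_, ?_⟩
  · intro a c ha hac hc
    exact count_tendsto b hb _ (Set.Ico a c) a c hac
      (fun t ht => ⟨ha.trans ht.1, ht.2.trans_le hc⟩) Set.Ioo_subset_Ico_self
      Set.Ico_subset_Icc_self (fun n => Iff.rfl)
  · intro s hs hsb
    have hs0 : 0 ≤ Real.logb b s := Real.logb_nonneg hb1 hs
    have hs1 : Real.logb b s < 1 := by
      rw [Real.logb_lt_iff_lt_rpow hb1 (by linarith), Real.rpow_one]; exact hsb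
    have := count_tendsto b hb (fun n => signif b (Nat.fib n : ℝ) ≤ s)
      (Set.Icc 0 (Real.logb b s)) 0 (Real.logb b s) hs0
      (fun t ht => ⟨ht.1, ht.2.trans_lt hs1⟩) Set.Ioo_subset_Icc_self subset_rfl (fun n => by
        have p2 : (Nat.fib (n + 1) : ℝ) ≠ 0 := by
          exact_mod_cast (Nat.fib_pos.mpr (Nat.succ_pos _)).ne'
        rw [signif, if_neg p2, Nat.abs_cast, Int.self_sub_floor,
          ← Real.le_logb_iff_rpow_le hb1 (by linarith)]
        exact ⟨fun h => ⟨Int.fract_nonneg _, h⟩, fun h => h.2⟩)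
    rw [sub_zero] at this
    exact this
end
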